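/- arXiv:1009.4044 — 3 statements merged into one kernel-verified Lean document; each statement's English description precedes it below -/
import Mathlib

section
/- In the symmetric group S5 on the set {1,2,3,4,5}, every subgroup isomorphic to the Klein four-group C2 × C2 is conjugate to exactly one of the two subgroups ⟨(12), (34)⟩ and ⟨(12)(34), (13)(24)⟩; moreover these two subgroups are not conjugate in S5. Hence the isomorphism type C2 × C2 occurs for exactly two conjugacy classes of subgroups of S5. -/
/-- The conjugate `g H g⁻¹` of a subgroup `H` by an element `g`. -/
def conjSubgroup {G : Type*} [Group G] (g : G) (H : Subgroup G) : Subgroup G :=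
  Subgroup.map (MulAut.conj g).toMonoidHom H

set_option maxRecDepth 100000 in
set_option synthInstance.maxHeartbeats 400000 in
set_option synthInstance.maxSize 4000 in
set_option maxHeartbeats 1000000 in
theorem key : ∀ a : Equiv.Perm (Fin 5), a * a = 1 → a ≠ 1 → ∀ b : Equiv.Perm (Fin 5), b * b = 1 →
    b ≠ 1 → a ≠ b → a * b = b * a → ∃ g : Equiv.Perm (Fin 5),
    (g * Equiv.swap 0 1 * g⁻¹ ∈ [a, b, a * b] ∧ g * Equiv.swap 2 3 * g⁻¹ ∈ [a, b, a * b]) ∨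
    (g * (Equiv.swap 0 1 * Equiv.swap 2 3) * g⁻¹ ∈ [a, b, a * b] ∧
      g * (Equiv.swap 0 2 * Equiv.swap 1 3) * g⁻¹ ∈ [a, b, a * b]) := by
  decide +kernel

theorem conj_eq (H : Subgroup (Equiv.Perm (Fin 5))) (hc : Nat.card H = 4)
    (g s t : Equiv.Perm (Fin 5)) (hs : g * s * g⁻¹ ∈ H) (ht : g * t * g⁻¹ ∈ H)
    (hn : [1, s, t, s * t].Nodup) :
    conjSubgroup g (Subgroup.closure {s, t}) = H := by
  have hle : conjSubgroup g (Subgroup.closure {s, t}) ≤ H := by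
    unfold conjSubgroup
    rw [Subgroup.map_le_iff_le_comap, Subgroup.closure_le]
    rintro x (rfl | rfl)
    · simpa using hs
    · simpa using ht
  apply Subgroup.eq_of_le_of_card_ge hle
  rw [hc]
  unfold conjSubgroup
  rw [Subgroup.card_map_of_injective (MulAut.conj g).injective]
  have h1 : s ∈ Subgroup.closure {s, t} := Subgroup.subset_closure (by simp)
  have h2 : t ∈ Subgroup.closure {s, t} := Subgroup.subset_closure (by simp)
  have hsub : (([1, s, t, s * t].toFinset : Finset _) : Set (Equiv.Perm (Fin 5))) ⊆
      (Subgroup.closure {s, t} : Subgroup _) := by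
    intro x hx
    simp only [List.coe_toFinset, Set.mem_ofPred_eq, List.mem_cons, List.not_mem_nil, or_false] at hx
    rcases hx with rfl | rfl | rfl | rfl
    · exact one_mem _
    · exact h1
    · exact h2
    · exact mul_mem h1 h2
  have := Set.ncard_le_ncard hsub (Set.toFinite _)
  rw [Set.ncard_coe_finset, List.toFinset_card_of_nodup hn] at this
  exact this

/-- In `S₅`, every subgroup isomorphic to the Klein four-group `C₂ × C₂` (i.e. of order 4
with every element of order dividing 2) is conjugate to exactly one of `⟨(12), (34)⟩` and
`⟨(12)(34), (13)(24)⟩`, and these two subgroups are not conjugate: the isomorphism type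
`C₂ × C₂` occurs for exactly two conjugacy classes of subgroups of `S₅`. -/
theorem stmt_9 :
    (∀ H : Subgroup (Equiv.Perm (Fin 5)), Nat.card H = 4 → (∀ h ∈ H, h * h = 1) →
      (∃ g, conjSubgroup g
        (Subgroup.closure {Equiv.swap (0 : Fin 5) 1, Equiv.swap 2 3}) = H) ∨
      (∃ g, conjSubgroup g
        (Subgroup.closure {Equiv.swap (0 : Fin 5) 1 * Equiv.swap 2 3,
          Equiv.swap (0 : Fin 5) 2 * Equiv.swap 1 3}) = H)) ∧
    ¬ ∃ g : Equiv.Perm (Fin 5),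
      conjSubgroup g (Subgroup.closure {Equiv.swap (0 : Fin 5) 1, Equiv.swap 2 3}) =
        Subgroup.closure {Equiv.swap (0 : Fin 5) 1 * Equiv.swap 2 3,
          Equiv.swap (0 : Fin 5) 2 * Equiv.swap 1 3} := by
  constructor
  · intro H hc hi
    have hex : ∀ l : List (Equiv.Perm (Fin 5)), l.length < 4 → ∃ x ∈ H, x ∉ l := by
      intro l hl
      by_contra hcon
      push Not at hcon
      have hsub : (H : Set (Equiv.Perm (Fin 5))) ⊆ (l.toFinset : Set _) := by
        intro x hx
        simpa using hcon x hx
      have h1 := Set.ncard_le_ncard hsub (Set.toFinite _)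
      rw [Set.ncard_coe_finset] at h1
      have h2 : (H : Set (Equiv.Perm (Fin 5))).ncard = 4 := hc
      have h3 := List.toFinset_card_le l
      omega
    obtain ⟨a, ha, ha1⟩ := hex [1] (by simp)
    obtain ⟨b, hb, hb1⟩ := hex [1, a] (by simp)
    simp only [List.mem_cons, List.not_mem_nil, or_false, not_or] at ha1 hb1
    have hab := hi _ (mul_mem ha hb)
    have hcomm : a * b = b * a := by
      have e1 : a⁻¹ = a := inv_eq_of_mul_eq_one_left (hi a ha)
      have e2 : b⁻¹ = b := inv_eq_of_mul_eq_one_left (hi b hb)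
      have e3 := inv_eq_of_mul_eq_one_left hab
      rw [mul_inv_rev, e1, e2] at e3
      exact e3.symm
    have hmem : ∀ x ∈ [a, b, a * b], x ∈ H := by
      intro x hx
      simp only [List.mem_cons, List.not_mem_nil, or_false] at hx
      rcases hx with rfl | rfl | rfl
      · exact ha
      · exact hb
      · exact mul_mem ha hb
    obtain ⟨g, ⟨h1, h2⟩ | ⟨h1, h2⟩⟩ :=
      key a (hi a ha) ha1 b (hi b hb) hb1.1 (Ne.symm hb1.2) hcomm
    · exact Or.inl ⟨g, conj_eq H hc g _ _ (hmem _ h1) (hmem _ h2) (by decide +kernel)⟩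
    · exact Or.inr ⟨g, conj_eq H hc g _ _ (hmem _ h1) (hmem _ h2) (by decide +kernel)⟩
  · rintro ⟨g, hg⟩
    have hmem : g * Equiv.swap 0 1 * g⁻¹ ∈ conjSubgroup g
        (Subgroup.closure {Equiv.swap (0 : Fin 5) 1, Equiv.swap 2 3}) :=
      ⟨Equiv.swap 0 1, Subgroup.subset_closure (by simp), by simp⟩
    rw [hg] at hmem
    have hle : Subgroup.closure {Equiv.swap (0 : Fin 5) 1 * Equiv.swap 2 3,
          Equiv.swap (0 : Fin 5) 2 * Equiv.swap 1 3} ≤ (Equiv.Perm.sign (α := Fin 5)).ker := by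
      rw [Subgroup.closure_le]
      rintro x (rfl | rfl)
      · show Equiv.Perm.sign _ = 1
        decide +kernel
      · show Equiv.Perm.sign _ = 1
        decide +kernel
    have h := hle hmem
    rw [MonoidHom.mem_ker, map_mul, map_mul, map_inv, mul_right_comm, mul_inv_cancel, one_mul,
      Equiv.Perm.sign_swap (by decide)] at h
    exact absurd h (by decide)
end

section
/- There are exactly two conjugacy classes of injective group homomorphisms from the dihedral group D4 of order 8 into the symmetric group S5: there exist injective homomorphisms f1, f2 : D4 → S5 that are not conjugate (there is no g in S5 with f2(x) = g f1(x) g^{-1} for all x), and every injective homomorphism f : D4 → S5 is conjugate to f1 or to f2. -/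
namespace D4S5

/-- The 4-cycle (0 1 2 3). -/
def c : Equiv.Perm (Fin 5) := ⟨![1,2,3,0,4], ![3,0,1,2,4], by decide, by decide⟩
/-- The transposition (1 3). -/
def t1 : Equiv.Perm (Fin 5) := ⟨![0,3,2,1,4], ![0,3,2,1,4], by decide, by decide⟩
/-- The double transposition (0 1)(2 3). -/
def t2 : Equiv.Perm (Fin 5) := ⟨![1,0,3,2,4], ![1,0,3,2,4], by decide, by decide⟩

/-- The underlying function of the homomorphism sending r to c and s to t. -/
def F (t : Equiv.Perm (Fin 5)) : DihedralGroup 4 → Equiv.Perm (Fin 5)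
  | .r i => c ^ i.val
  | .sr i => t * c ^ i.val

def f1 : DihedralGroup 4 →* Equiv.Perm (Fin 5) where
  toFun := F t1
  map_one' := by decide +kernel
  map_mul' := by decide +kernel

def f2 : DihedralGroup 4 →* Equiv.Perm (Fin 5) where
  toFun := F t2
  map_one' := by decide +kernel
  map_mul' := by decide +kernel

theorem inj1 : Function.Injective f1 := by
  have : ∀ a b, f1 a = f1 b → a = b := by decide +kernel
  exact this

theorem inj2 : Function.Injective f2 := by
  have : ∀ a b, f2 a = f2 b → a = b := by decide +kernel
  exact this

theorem nconj : ∀ g : Equiv.Perm (Fin 5), ¬ (t2 * g = g * t1) := by decide +kernel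

theorem conj_c : ∀ s : Equiv.Perm (Fin 5), s ^ 4 = 1 → s ^ 2 ≠ 1 → ∃ g, s * g = g * c := by
  decide +kernel

theorem class_t : ∀ t : Equiv.Perm (Fin 5), t * t = 1 → t * c * t * c = 1 →
    ∃ n : Fin 4, t * c ^ n.val = c ^ n.val * t1 ∨ t * c ^ n.val = c ^ n.val * t2 := by
  decide +kernel

theorem gen : ∀ x : DihedralGroup 4, ∃ n : Fin 4,
    x = .r 1 ^ n.val ∨ x = .sr 0 * .r 1 ^ n.val := by
  decide +kernel

theorem ext_conj (f f' : DihedralGroup 4 →* Equiv.Perm (Fin 5)) (g : Equiv.Perm (Fin 5))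
    (h1 : f (.r 1) * g = g * f' (.r 1)) (h2 : f (.sr 0) * g = g * f' (.sr 0)) (x) :
    f x = g * f' x * g⁻¹ := by
  have h1' : f (.r 1) = g * f' (.r 1) * g⁻¹ := eq_mul_inv_of_mul_eq h1
  have h2' : f (.sr 0) = g * f' (.sr 0) * g⁻¹ := eq_mul_inv_of_mul_eq h2
  obtain ⟨n, rfl | rfl⟩ := gen x
  · rw [map_pow, map_pow, h1', conj_pow]
  · rw [map_mul, map_mul, map_pow, map_pow, h1', h2', conj_pow]
    group

theorem classify (f : DihedralGroup 4 →* Equiv.Perm (Fin 5)) (hf : Function.Injective f) :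
    (∃ g : Equiv.Perm (Fin 5), ∀ x, f x = g * f1 x * g⁻¹) ∨
    (∃ g : Equiv.Perm (Fin 5), ∀ x, f x = g * f2 x * g⁻¹) := by
  have e4 : f (.r 1) ^ 4 = 1 := by
    rw [← map_pow, ← map_one f]; congr 1
  have e2 : f (.r 1) ^ 2 ≠ 1 := by
    rw [← map_pow, ← map_one f]
    intro h
    exact absurd (hf h) (by decide)
  obtain ⟨g, hg⟩ := conj_c _ e4 e2
  have hc : c = g⁻¹ * f (.r 1) * g := by rw [mul_assoc, hg]; group
  have et : f (.sr 0) * f (.sr 0) = 1 := by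
    rw [← map_mul, ← map_one f]; congr 1
  have er : f (.sr 0) * f (.r 1) * f (.sr 0) * f (.r 1) = 1 := by
    rw [← map_mul, ← map_mul, ← map_mul, ← map_one f]; congr 1
  have key := class_t (g⁻¹ * f (.sr 0) * g)
    (by
      calc _ = g⁻¹ * (f (.sr 0) * f (.sr 0)) * g := by group
        _ = 1 := by rw [et]; group)
    (by
      rw [hc]
      calc _ = g⁻¹ * (f (.sr 0) * f (.r 1) * f (.sr 0) * f (.r 1)) * g := by group
        _ = 1 := by rw [er]; group)
  have r1 : f1 (.r 1) = c := by decide +kernel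
  have r2 : f2 (.r 1) = c := by decide +kernel
  have s1 : f1 (.sr 0) = t1 := by decide +kernel
  have s2 : f2 (.sr 0) = t2 := by decide +kernel
  obtain ⟨n, h⟩ := key
  have hr : f (.r 1) * (g * c ^ n.val) = g * c ^ n.val * c := by
    rw [← mul_assoc, hg, mul_assoc, mul_assoc, ← pow_succ, ← pow_succ']
  refine h.imp (fun h => ⟨g * c ^ n.val, ext_conj _ _ _ (by rw [r1, hr]) ?_⟩)
    (fun h => ⟨g * c ^ n.val, ext_conj _ _ _ (by rw [r2, hr]) ?_⟩)
  · rw [s1, mul_assoc g, ← h]; simp only [mul_assoc, mul_inv_cancel_left]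
  · rw [s2, mul_assoc g, ← h]; simp only [mul_assoc, mul_inv_cancel_left]

end D4S5



/-- There are exactly two conjugacy classes of injective group homomorphisms from the
dihedral group `D₄` of order 8 into `S₅`: two non-conjugate injective homomorphisms
exist, and every injective homomorphism is conjugate to one of them. -/
theorem stmt_15 :
    ∃ f1 f2 : DihedralGroup 4 →* Equiv.Perm (Fin 5),
      Function.Injective f1 ∧ Function.Injective f2 ∧
      (¬ ∃ g : Equiv.Perm (Fin 5), ∀ x, f2 x = g * f1 x * g⁻¹) ∧
      (∀ f : DihedralGroup 4 →* Equiv.Perm (Fin 5), Function.Injective f →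
        (∃ g : Equiv.Perm (Fin 5), ∀ x, f x = g * f1 x * g⁻¹) ∨
        (∃ g : Equiv.Perm (Fin 5), ∀ x, f x = g * f2 x * g⁻¹)) := by
  refine ⟨D4S5.f1, D4S5.f2, D4S5.inj1, D4S5.inj2, ?_, D4S5.classify⟩
  rintro ⟨g, h⟩
  have s1 : D4S5.f1 (.sr 0) = D4S5.t1 := by decide +kernel
  have s2 : D4S5.f2 (.sr 0) = D4S5.t2 := by decide +kernel
  have h0 := h (.sr 0)
  rw [s1, s2] at h0
  apply D4S5.nconj g
  rw [h0]
  group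
end

section
/- There are exactly two conjugacy classes of injective group homomorphisms from the dihedral group D6 of order 12 into the symmetric group S5: there exist injective homomorphisms f1, f2 : D6 → S5 that are not conjugate (there is no g in S5 with f2(x) = g f1(x) g^{-1} for all x), and every injective homomorphism f : D6 → S5 is conjugate to f1 or to f2. -/
open Equiv in
def s0 : Equiv.Perm (Fin 5) := swap 0 1 * swap 1 2 * swap 3 4

open Equiv in
def t1 : Equiv.Perm (Fin 5) := swap 0 1

open Equiv in
def t2 : Equiv.Perm (Fin 5) := swap 0 1 * swap 3 4

def ff (t : Equiv.Perm (Fin 5)) : DihedralGroup 6 → Equiv.Perm (Fin 5)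
  | .r i => s0 ^ i.val
  | .sr i => t * s0 ^ i.val

lemma ff_mul (t : Equiv.Perm (Fin 5)) (ht : t = t1 ∨ t = t2) :
    ∀ x y, ff t (x * y) = ff t x * ff t y := by
  rcases ht with rfl | rfl
  all_goals
    rintro (i | i) (j | j)
    all_goals
      revert i j
      decide +kernel

def F (t : Equiv.Perm (Fin 5)) (ht : t = t1 ∨ t = t2) :
    DihedralGroup 6 →* Equiv.Perm (Fin 5) :=
  MonoidHom.mk' (ff t) (ff_mul t ht)

lemma ff_inj (t : Equiv.Perm (Fin 5)) (ht : t = t1 ∨ t = t2) :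
    Function.Injective (ff t) := by
  rcases ht with rfl | rfl
  all_goals
    rintro (i | i) (j | j)
    all_goals
      revert i j
      decide +kernel

lemma conj_s : ∀ s : Equiv.Perm (Fin 5), s ^ 6 = 1 → s ^ 2 ≠ 1 → s ^ 3 ≠ 1 →
    ∃ g : Equiv.Perm (Fin 5), s = g * s0 * g⁻¹ := by
  decide +kernel

lemma conj_t : ∀ t : Equiv.Perm (Fin 5), t * t = 1 → t * s0 * t = s0⁻¹ →
    ∃ k : Fin 6, t = s0 ^ k.val * t1 * (s0 ^ k.val)⁻¹ ∨ t = s0 ^ k.val * t2 * (s0 ^ k.val)⁻¹ := by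
  decide +kernel

lemma not_conj : ∀ g : Equiv.Perm (Fin 5), t2 ≠ g * t1 * g⁻¹ := by
  decide +kernel

lemma ext_conj (f : DihedralGroup 6 →* Equiv.Perm (Fin 5)) (g t : Equiv.Perm (Fin 5))
    (hr : f (.r 1) = g * s0 * g⁻¹) (hs : f (.sr 0) = g * t * g⁻¹) :
    ∀ x, f x = g * ff t x * g⁻¹ := by
  have h1 : ∀ i : ZMod 6, f (.r i) = g * s0 ^ i.val * g⁻¹ := by
    intro i
    have : (DihedralGroup.r i : DihedralGroup 6) = (.r 1) ^ i.val := by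
      rw [DihedralGroup.r_one_pow, ZMod.natCast_zmod_val]
    rw [this, map_pow, hr, conj_pow]
  rintro (i | i)
  · exact h1 i
  · have : (DihedralGroup.sr i : DihedralGroup 6) = .sr 0 * .r i := by
      rw [DihedralGroup.sr_mul_r, zero_add]
    rw [this, map_mul, h1, hs, ← this]
    simp only [ff]
    group

lemma exists_conj (f : DihedralGroup 6 →* Equiv.Perm (Fin 5)) (hf : Function.Injective f) :
    (∃ g : Equiv.Perm (Fin 5), ∀ x, f x = g * ff t1 x * g⁻¹) ∨
    (∃ g : Equiv.Perm (Fin 5), ∀ x, f x = g * ff t2 x * g⁻¹) := by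
  have hne : ∀ x : DihedralGroup 6, x ≠ 1 → f x ≠ 1 := fun x hx h =>
    hx (hf (h.trans (map_one f).symm))
  obtain ⟨g, hg⟩ := conj_s (f (.r 1))
    (by rw [← map_pow, ← map_one f]; exact congrArg f (by decide))
    (by rw [← map_pow]; exact hne _ (by decide))
    (by rw [← map_pow]; exact hne _ (by decide))
  have hs : f (.sr 0) * f (.sr 0) = 1 := by
    rw [← map_mul, ← map_one f]; exact congrArg f (by decide)
  have hrel : f (.sr 0) * f (.r 1) * f (.sr 0) = (f (.r 1))⁻¹ := by
    rw [← map_mul, ← map_mul, ← map_inv]; exact congrArg f (by decide)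
  obtain ⟨k, hk⟩ := conj_t (g⁻¹ * f (.sr 0) * g)
    (by
      calc _ = g⁻¹ * (f (.sr 0) * f (.sr 0)) * g := by group
        _ = 1 := by rw [hs]; group)
    (by
      calc _ = g⁻¹ * (f (.sr 0) * (g * s0 * g⁻¹) * f (.sr 0)) * g := by group
        _ = s0⁻¹ := by rw [← hg, hrel, hg]; group)
  have hr : f (.r 1) = (g * s0 ^ k.val) * s0 * (g * s0 ^ k.val)⁻¹ := by
    rw [hg]; group
  have key : ∀ t, g⁻¹ * f (.sr 0) * g = s0 ^ k.val * t * (s0 ^ k.val)⁻¹ →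
      f (.sr 0) = (g * s0 ^ k.val) * t * (g * s0 ^ k.val)⁻¹ := by
    intro t h
    calc f (.sr 0) = g * (g⁻¹ * f (.sr 0) * g) * g⁻¹ := by group
      _ = _ := by rw [h]; group
  rcases hk with h | h
  · exact .inl ⟨_, ext_conj f _ _ hr (key _ h)⟩
  · exact .inr ⟨_, ext_conj f _ _ hr (key _ h)⟩


/-- There are exactly two conjugacy classes of injective group homomorphisms from the
dihedral group `D₆` of order 12 into `S₅`: two non-conjugate injective homomorphisms
exist, and every injective homomorphism is conjugate to one of them. -/
theorem stmt_16 :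
    ∃ f1 f2 : DihedralGroup 6 →* Equiv.Perm (Fin 5),
      Function.Injective f1 ∧ Function.Injective f2 ∧
      (¬ ∃ g : Equiv.Perm (Fin 5), ∀ x, f2 x = g * f1 x * g⁻¹) ∧
      (∀ f : DihedralGroup 6 →* Equiv.Perm (Fin 5), Function.Injective f →
        (∃ g : Equiv.Perm (Fin 5), ∀ x, f x = g * f1 x * g⁻¹) ∨
        (∃ g : Equiv.Perm (Fin 5), ∀ x, f x = g * f2 x * g⁻¹)) := by
  refine ⟨F t1 (.inl rfl), F t2 (.inr rfl), ff_inj _ (.inl rfl), ff_inj _ (.inr rfl), ?_,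
    exists_conj⟩
  rintro ⟨g, hg⟩
  exact not_conj g (by simpa [F, ff] using hg (.sr 0))
end
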